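/- Let X be a compact metric space and T : X → X a Lipschitz map. Suppose (X,T) is reducible in the following sense: there exists a dense subset D of Lip(X) such that for every φ* ∈ D that is not maximized by any periodic orbit, there exist an open neighborhood V of φ* in Lip(X) and a nonempty compact set Λ ⊆ X with TΛ = Λ, T : Λ → Λ open and distance-expanding, and such that every maximizing measure of every φ ∈ V is supported in Λ. Assume moreover the locking theorem (if φ is maximized by a periodic orbit O then for every ε > 0, φ - ε·dist(·,O) has an open neighborhood in Lip(X) of functions uniquely maximized by O) and the Contreras–Huang et al. theorem for expanding subsystems (for any Lipschitz, surjective, open, distance-expanding system and any Lipschitz function ψ and ε > 0, there is a periodic orbit O such that ψ - ε·dist(·,O) restricted to the subsystem is maximized by O). Then the set P_T of Lipschitz functions maximized by some periodic orbit of T is dense in Lip(X), and consequently Lipschitz TPO holds for (X,T). -/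

import Mathlib

open MeasureTheory Metric Set

section

variable {X : Type*} [MetricSpace X] [MeasurableSpace X]

/-- maximal ergodic average -/
noncomputable def beta (T : X → X) (φ : X → ℝ) : ℝ :=
  sSup ((fun μ : Measure X => ∫ x, φ x ∂μ) ''
    {μ : Measure X | IsProbabilityMeasure μ ∧ μ.map T = μ})

/-- averaged Dirac measure on a periodic orbit segment -/
noncomputable def orbMeas (T : X → X) (y : X) (p : ℕ) : Measure X :=
  (p : ENNReal)⁻¹ • ∑ k ∈ Finset.range p, Measure.dirac (T^[k] y)

/-- topological support of a measure -/
def msupp (μ : Measure X) : Set X := {x | ∀ U : Set X, IsOpen U → x ∈ U → 0 < μ U}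

/-- the set of real-valued Lipschitz functions on `X` -/
def LipFun (X : Type*) [MetricSpace X] : Set (X → ℝ) :=
  {φ | ∃ K : NNReal, LipschitzWith K φ}

/-- the Lipschitz norm `‖φ‖_∞ + lip(φ)` -/
noncomputable def lipNorm (φ : X → ℝ) : ℝ :=
  (⨆ x, |φ x|) + sSup {r : ℝ | ∃ x y : X, x ≠ y ∧ r = |φ x - φ y| / dist x y}

/-- distance in the Lipschitz norm -/
noncomputable def lipDist (φ ψ : X → ℝ) : ℝ := lipNorm (fun x => φ x - ψ x)

/-- `φ` is maximized by the periodic orbit of `y` of period `p` -/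
def MaximizedBy (T : X → X) (φ : X → ℝ) (y : X) (p : ℕ) : Prop :=
  ∀ ν : Measure X, IsProbabilityMeasure ν → ν.map T = ν →
    ∫ x, φ x ∂ν ≤ ∫ x, φ x ∂(orbMeas T y p)

/-- `φ` is uniquely maximized by the periodic orbit of `y` of period `p` -/
def UniquelyMaximizedBy (T : X → X) (φ : X → ℝ) (y : X) (p : ℕ) : Prop :=
  ∀ ν : Measure X, IsProbabilityMeasure ν → ν.map T = ν → ν ≠ orbMeas T y p →
    ∫ x, φ x ∂ν < ∫ x, φ x ∂(orbMeas T y p)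

/-- `T` is distance-expanding on `Λ` -/
def ExpandingOn (T : X → X) (Λ : Set X) : Prop :=
  ∃ n : ℕ, 1 ≤ n ∧ ∃ η : ℝ, 0 < η ∧ ∃ lam : ℝ, 1 < lam ∧
    ∀ x ∈ Λ, ∀ y ∈ Λ, dist x y ≤ 2 * η →
      lam * dist x y ≤ dist (T^[n] x) (T^[n] y)

/-- `T : Λ → Λ` is an open map for the subspace topology -/
def OpenOn (T : X → X) (Λ : Set X) : Prop :=
  ∀ V : Set X, IsOpen V → ∃ W : Set X, IsOpen W ∧ T '' (V ∩ Λ) = W ∩ Λ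

/-- the collection of Lipschitz functions maximized by some periodic orbit -/
def PT (T : X → X) : Set (X → ℝ) :=
  {φ | φ ∈ LipFun X ∧ ∃ y : X, ∃ p : ℕ, 0 < p ∧ T^[p] y = y ∧ MaximizedBy T φ y p}

end

section helpers

theorem aux_lipBdd {X : Type*} [MetricSpace X] {f : X → ℝ} (hf : f ∈ LipFun X) :
    BddAbove {r : ℝ | ∃ x y : X, x ≠ y ∧ r = |f x - f y| / dist x y} := by
  obtain ⟨K, hK⟩ := hf
  refine ⟨K, ?_⟩
  rintro r ⟨x, y, hxy, rfl⟩
  rw [div_le_iff₀ (dist_pos.2 hxy)]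
  simpa [Real.dist_eq] using hK.dist_le_mul x y

theorem aux_supBdd {X : Type*} [MetricSpace X] [CompactSpace X] {f : X → ℝ}
    (hf : f ∈ LipFun X) : BddAbove (Set.range fun x => |f x|) := by
  obtain ⟨K, hK⟩ := hf
  exact (isCompact_range hK.continuous.abs).bddAbove

theorem aux_sub {X : Type*} [MetricSpace X] {f g : X → ℝ}
    (hf : f ∈ LipFun X) (hg : g ∈ LipFun X) : (fun x => f x - g x) ∈ LipFun X := by
  obtain ⟨K, hK⟩ := hf
  obtain ⟨L, hL⟩ := hg
  exact ⟨K + L, hK.sub hL⟩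

theorem aux_smul_infDist {X : Type*} [MetricSpace X] (e : ℝ) (S : Set X) :
    (fun x => e * infDist x S) ∈ LipFun X := by
  refine ⟨‖e‖₊ * 1, ?_⟩
  exact LipschitzWith.of_dist_le_mul fun x y => by
    have := (lipschitz_infDist_pt S).dist_le_mul x y
    simp only [Real.dist_eq, NNReal.coe_mul, coe_nnnorm, Real.norm_eq_abs] at this ⊢
    rw [← mul_sub, abs_mul, mul_assoc]
    exact mul_le_mul_of_nonneg_left this (abs_nonneg e)

theorem aux_norm_le {X : Type*} [MetricSpace X] [MeasurableSpace X] [Nonempty X]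
    {f : X → ℝ} {a b : ℝ} (hb : 0 ≤ b) (h1 : ∀ x, |f x| ≤ a)
    (h2 : ∀ x y, x ≠ y → |f x - f y| / dist x y ≤ b) : lipNorm f ≤ a + b := by
  unfold lipNorm
  refine add_le_add (ciSup_le h1) (Real.sSup_le ?_ hb)
  rintro r ⟨x, y, hxy, rfl⟩
  exact h2 x y hxy

theorem aux_tri {X : Type*} [MetricSpace X] [MeasurableSpace X] [CompactSpace X] [Nonempty X]
    {f g h : X → ℝ} (hf : f ∈ LipFun X) (hg : g ∈ LipFun X) (hh : h ∈ LipFun X) :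
    lipDist f h ≤ lipDist f g + lipDist g h := by
  have A := aux_sub hf hg
  have B := aux_sub hg hh
  have key := aux_norm_le (f := fun x => f x - h x)
    (a := (⨆ x, |f x - g x|) + ⨆ x, |g x - h x|)
    (b := sSup {r : ℝ | ∃ x y : X, x ≠ y ∧ r = |(f x - g x) - (f y - g y)| / dist x y} +
      sSup {r : ℝ | ∃ x y : X, x ≠ y ∧ r = |(g x - h x) - (g y - h y)| / dist x y})
    (by
      apply add_nonneg <;>
      · apply Real.sSup_nonneg
        rintro r ⟨x, y, -, rfl⟩
        positivity)
    (fun x => by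
      have a1 := le_ciSup (aux_supBdd A) x
      have a2 := le_ciSup (aux_supBdd B) x
      have a3 := abs_add_le (f x - g x) (g x - h x)
      rw [sub_add_sub_cancel] at a3
      linarith)
    (fun x y hxy => by
      have a1 := le_csSup (aux_lipBdd A) ⟨x, y, hxy, rfl⟩
      have a2 := le_csSup (aux_lipBdd B) ⟨x, y, hxy, rfl⟩
      refine le_trans ?_ (add_le_add a1 a2)
      rw [← add_div]
      refine div_le_div_of_nonneg_right ?_ dist_nonneg
      have a3 := abs_add_le ((f x - g x) - (f y - g y)) ((g x - h x) - (g y - h y))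
      refine le_trans (le_of_eq ?_) a3
      congr 1
      ring)
  unfold lipDist
  refine key.trans (le_of_eq ?_)
  unfold lipNorm
  ring

theorem aux_comm {X : Type*} [MetricSpace X] [MeasurableSpace X] (f g : X → ℝ) :
    lipDist f g = lipDist g f := by
  unfold lipDist lipNorm
  have h1 : ∀ x, |f x - g x| = |g x - f x| := fun x => abs_sub_comm _ _
  have h2 : ∀ x y, |f x - g x - (f y - g y)| = |g x - f x - (g y - f y)| := fun x y => by
    rw [← abs_neg]; congr 1; ring
  simp only [h1, h2]

theorem aux_perturb {X : Type*} [MetricSpace X] [MeasurableSpace X] [CompactSpace X] [Nonempty X]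
    (f : X → ℝ) {e : ℝ} (he : 0 ≤ e) {S : Set X} (hS : S.Nonempty) :
    lipDist f (fun x => f x - e * infDist x S) ≤ e * (diam (Set.univ : Set X) + 1) := by
  unfold lipDist
  simp only [sub_sub_cancel]
  rw [mul_add]
  refine aux_norm_le (by linarith) (fun x => ?_) (fun x y hxy => ?_)
  · rw [abs_of_nonneg (mul_nonneg he infDist_nonneg)]
    obtain ⟨s, hs⟩ := hS
    refine mul_le_mul_of_nonneg_left ((infDist_le_dist_of_mem hs).trans ?_) he
    exact dist_le_diam_of_mem isCompact_univ.isBounded (mem_univ _) (mem_univ _)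
  · rw [div_le_iff₀ (dist_pos.2 hxy), ← mul_sub, abs_mul, abs_of_nonneg he, mul_assoc]
    have := (lipschitz_infDist_pt S).dist_le_mul x y
    rw [Real.dist_eq] at this
    exact mul_le_mul_of_nonneg_left (by simpa using this) he

theorem aux_exists_max {X : Type*} [MetricSpace X] [CompactSpace X]
    [MeasurableSpace X] [BorelSpace X] {T : X → X} (hT : Continuous T) {f : X → ℝ}
    (hf : Continuous f) (ν : Measure X) (hν : IsProbabilityMeasure ν) (hi : ν.map T = ν) :
    ∃ μ : Measure X, IsProbabilityMeasure μ ∧ μ.map T = μ ∧ ∫ x, f x ∂μ = beta T f ∧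
      ∀ ν : Measure X, IsProbabilityMeasure ν → ν.map T = ν → ∫ x, f x ∂ν ≤ ∫ x, f x ∂μ := by
  let I : Set (ProbabilityMeasure X) := {μ | μ.map hT.measurable.aemeasurable = μ}
  have hmem : ∀ μ : ProbabilityMeasure X, μ ∈ I ↔ (μ : Measure X).map T = μ := fun μ => by
    constructor
    · intro h
      exact congrArg (fun m : ProbabilityMeasure X => (m : Measure X)) h
    · intro h
      exact Subtype.ext h
  have hIc : IsCompact I :=
    (isClosed_eq (ProbabilityMeasure.continuous_map hT) continuous_id).isCompact
  let F : BoundedContinuousFunction X ℝ := BoundedContinuousFunction.mkOfCompact ⟨f, hf⟩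
  have hcont : Continuous fun μ : ProbabilityMeasure X => ∫ x, f x ∂(μ : Measure X) := by
    rw [continuous_iff_continuousAt]
    intro μ
    exact (ProbabilityMeasure.tendsto_iff_forall_integral_tendsto.1 Filter.tendsto_id) F
  obtain ⟨μ, hμ, hmax⟩ := hIc.exists_isMaxOn ⟨⟨ν, hν⟩, (hmem _).2 hi⟩ hcont.continuousOn
  have hmax' : ∀ ν : Measure X, IsProbabilityMeasure ν → ν.map T = ν →
      ∫ x, f x ∂ν ≤ ∫ x, f x ∂(μ : Measure X) := fun ν h1 h2 =>
    hmax (a := (⟨ν, h1⟩ : ProbabilityMeasure X)) ((hmem _).2 h2)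
  refine ⟨μ, inferInstance, (hmem _).1 hμ, ?_, hmax'⟩
  symm
  apply IsGreatest.csSup_eq
  refine ⟨⟨μ, ⟨inferInstance, (hmem _).1 hμ⟩, rfl⟩, ?_⟩
  rintro _ ⟨ν, ⟨h1, h2⟩, rfl⟩
  exact hmax' ν h1 h2

theorem aux_small {C ε : ℝ} (hC : 0 ≤ C) (hε : 0 < ε) : ∃ e : ℝ, 0 < e ∧ e * (C + 1) < ε := by
  refine ⟨ε / (2 * (C + 1)), by positivity, ?_⟩
  have : ε / (2 * (C + 1)) * (C + 1) = ε / 2 := by field_simp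
  linarith

end helpers

/-- if `(X,T)` is reducible, then (granting the locking theorem
and the Contreras–Huang et al. theorem for expanding subsystems) the set `P_T`
is dense in `Lip(X)` and Lipschitz TPO holds for `(X,T)`. -/
theorem stmt8 {X : Type*} [MetricSpace X] [CompactSpace X] [Nonempty X]
    [MeasurableSpace X] [BorelSpace X]
    (T : X → X) (KT : NNReal) (hT : LipschitzWith KT T)
    -- reducibility
    (hred : ∃ D : Set (X → ℝ), D ⊆ LipFun X ∧
      (∀ φ ∈ LipFun X, ∀ ε : ℝ, 0 < ε → ∃ φ' ∈ D, lipDist φ φ' < ε) ∧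
      ∀ φs ∈ D, φs ∉ PT T → ∃ ε : ℝ, 0 < ε ∧ ∃ Λ : Set X,
        Λ.Nonempty ∧ IsCompact Λ ∧ T '' Λ = Λ ∧ OpenOn T Λ ∧ ExpandingOn T Λ ∧
        ∀ φ ∈ LipFun X, lipDist φ φs < ε →
          ∀ μ : Measure X, IsProbabilityMeasure μ → μ.map T = μ →
            ∫ x, φ x ∂μ = beta T φ → msupp μ ⊆ Λ)
    -- the locking theorem
    (hlock : ∀ φ ∈ LipFun X, ∀ (y : X) (p : ℕ), 0 < p → T^[p] y = y →
      MaximizedBy T φ y p → ∀ ε : ℝ, 0 < ε → ∃ δ : ℝ, 0 < δ ∧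
        ∀ ψ ∈ LipFun X,
          lipDist ψ (fun x => φ x - ε * infDist x ((fun k => T^[k] y) '' Set.Iio p)) < δ →
          UniquelyMaximizedBy T ψ y p)
    -- the Contreras–Huang et al. theorem for expanding subsystems
    (hcon : ∀ Λ : Set X, Λ.Nonempty → IsCompact Λ → T '' Λ = Λ → OpenOn T Λ →
      ExpandingOn T Λ → ∀ ψ ∈ LipFun X, ∀ ε : ℝ, 0 < ε →
        ∃ y ∈ Λ, ∃ p : ℕ, 0 < p ∧ T^[p] y = y ∧
          ∀ ν : Measure X, IsProbabilityMeasure ν → ν.map T = ν → msupp ν ⊆ Λ →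
            ∫ x, (ψ x - ε * infDist x ((fun k => T^[k] y) '' Set.Iio p)) ∂ν ≤
              ∫ x, (ψ x - ε * infDist x ((fun k => T^[k] y) '' Set.Iio p))
                ∂(orbMeas T y p)) :
    -- conclusion: density of P_T, and Lipschitz TPO
    (∀ φ ∈ LipFun X, ∀ ε : ℝ, 0 < ε → ∃ φ' ∈ PT T, lipDist φ φ' < ε) ∧
    (∃ G : Set (X → ℝ), G ⊆ LipFun X ∧
      (∀ φ ∈ LipFun X, ∀ ε : ℝ, 0 < ε → ∃ φ' ∈ G, lipDist φ φ' < ε) ∧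
      ∀ φ ∈ G, ∃ ε : ℝ, 0 < ε ∧ ∃ y : X, ∃ p : ℕ, 0 < p ∧ T^[p] y = y ∧
        ∀ ψ ∈ LipFun X, lipDist ψ φ < ε → UniquelyMaximizedBy T ψ y p) := by
  have orbNe : ∀ (y : X) (p : ℕ), 0 < p → ((fun k => T^[k] y) '' Set.Iio p).Nonempty :=
    fun y p hp => ⟨_, 0, hp, rfl⟩
  have dense : ∀ φ ∈ LipFun X, ∀ ε : ℝ, 0 < ε → ∃ φ' ∈ PT T, lipDist φ φ' < ε := by
    intro φ hφ ε hε
    obtain ⟨D, hD, hDd, hDr⟩ := hred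
    obtain ⟨φs, hs, hds⟩ := hDd φ hφ (ε / 2) (by linarith)
    by_cases hP : φs ∈ PT T
    · exact ⟨φs, hP, by linarith⟩
    obtain ⟨ε₀, hε₀, Λ, hne, hc, hinv, hop, hexp, hsupp⟩ := hDr φs hs hP
    obtain ⟨e, he, hes⟩ := aux_small (C := diam (Set.univ : Set X)) (ε := min (ε / 2) ε₀)
      diam_nonneg (lt_min (by linarith) hε₀)
    obtain ⟨y, -, p, hp, hper, hmax⟩ := hcon Λ hne hc hinv hop hexp φs (hD hs) e he
    have hd := (aux_perturb φs he.le (orbNe y p hp)).trans_lt hes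
    have hL := aux_sub (hD hs) (aux_smul_infDist e ((fun k => T^[k] y) '' Set.Iio p))
    refine ⟨_, ⟨hL, y, p, hp, hper, ?_⟩, (aux_tri hφ (hD hs) hL).trans_lt ?_⟩
    · intro ν h1 h2
      obtain ⟨K, hK⟩ := hL
      obtain ⟨μ, m1, m2, m3, m4⟩ := aux_exists_max hT.continuous hK.continuous ν h1 h2
      refine (m4 ν h1 h2).trans (hmax μ m1 m2 ?_)
      refine hsupp _ ⟨K, hK⟩ ?_ μ m1 m2 m3
      rw [aux_comm]
      exact hd.trans_le (min_le_right _ _)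
    · have := hd.trans_le (min_le_left _ _)
      linarith
  refine ⟨dense, {φ | φ ∈ LipFun X ∧ ∃ ε : ℝ, 0 < ε ∧ ∃ y : X, ∃ p : ℕ, 0 < p ∧ T^[p] y = y ∧
        ∀ ψ ∈ LipFun X, lipDist ψ φ < ε → UniquelyMaximizedBy T ψ y p}, fun φ h => h.1, ?_,
        fun φ h => h.2⟩
  intro φ hφ ε hε
  obtain ⟨φ', ⟨hφ', y, p, hp, hper, hm⟩, hd⟩ := dense φ hφ (ε / 2) (by linarith)
  obtain ⟨e, he, hes⟩ := aux_small (C := diam (Set.univ : Set X)) (ε := ε / 2)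
      diam_nonneg (by linarith)
  have hL := aux_sub hφ' (aux_smul_infDist e ((fun k => T^[k] y) '' Set.Iio p))
  obtain ⟨δ, hδ, hu⟩ := hlock φ' hφ' y p hp hper hm e he
  refine ⟨_, ⟨hL, δ, hδ, y, p, hp, hper, hu⟩, (aux_tri hφ hφ' hL).trans_lt ?_⟩
  have := aux_perturb φ' he.le (orbNe y p hp)
  linarith
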